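/- arXiv:1211.2496 — 4 statements merged into one kernel-verified Lean document; each statement's English description precedes it below -/
import Mathlib

section
/- Let i ≥ 1 be an integer, let 0 < η ≤ 1, and let θ₁, …, θᵢ be independent random variables, each uniformly distributed on [0, 2π). Then the probability that there exists an arc of the circle of angular length 2πη containing none of the points θ₁, …, θᵢ (i.e., the probability that there exists t ∈ [0, 2π) such that for every j, θⱼ does not lie in {t + u (mod 2π) : 0 ≤ u < 2πη}) is at most i(1 − η)^{i−1}. -/
open MeasureTheory Real

/-- The uniform probability measure on `[0, 2π)`. -/
noncomputable def uniformCircle : Measure ℝ :=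
  (ENNReal.ofReal (2 * π))⁻¹ • volume.restrict (Set.Ico 0 (2 * π))

/-- Membership of a point `x ∈ [0, 2π)` in the arc of angular length `2πη`
starting at `t ∈ [0, 2π)`, i.e. `x = t + u (mod 2π)` for some `0 ≤ u < 2πη`. -/
def inArc (η t x : ℝ) : Prop :=
  ∃ u, 0 ≤ u ∧ u < 2 * π * η ∧ (x = t + u ∨ x = t + u - 2 * π)

instance isProbabilityMeasure_uniformCircle : IsProbabilityMeasure uniformCircle := by
  refine ⟨?_⟩
  have h : 0 < 2 * π := by positivity
  simp only [uniformCircle, Measure.smul_apply, Measure.restrict_apply_univ, Real.volume_Ico,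
    sub_zero, smul_eq_mul]
  exact ENNReal.inv_mul_cancel (ENNReal.ofReal_pos.2 h).ne' ENNReal.ofReal_ne_top

theorem ae_mem_Ico_uniformCircle : ∀ᵐ x ∂uniformCircle, x ∈ Set.Ico (0 : ℝ) (2 * π) :=
  Measure.ae_smul_measure (ae_restrict_mem measurableSet_Ico) _

/-- For `a, x ∈ [0, 2π)`, the counterclockwise distance from `a` to `x`, in turns. -/
theorem fract_div_two_pi {a x : ℝ} (ha : a ∈ Set.Ico (0 : ℝ) (2 * π))
    (hx : x ∈ Set.Ico (0 : ℝ) (2 * π)) :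
    a ≤ x ∧ 2 * π * Int.fract ((x - a) / (2 * π)) = x - a ∨
      x < a ∧ 2 * π * Int.fract ((x - a) / (2 * π)) = x - a + 2 * π := by
  have h : 0 < 2 * π := by positivity
  obtain ⟨ha0, ha1⟩ := ha
  obtain ⟨hx0, hx1⟩ := hx
  rcases le_or_gt a x with hax | hax
  · refine Or.inl ⟨hax, ?_⟩
    rw [Int.fract_eq_self.2 ⟨div_nonneg (by linarith) h.le, (div_lt_one h).2 (by linarith)⟩]
    field_simp
  · refine Or.inr ⟨hax, ?_⟩
    have h1 : (x - a) / (2 * π) + 1 = (x - a + 2 * π) / (2 * π) := by field_simp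
    rw [← Int.fract_add_one, h1,
      Int.fract_eq_self.2 ⟨div_nonneg (by linarith) h.le, (div_lt_one h).2 (by linarith)⟩]
    field_simp

theorem le_fract_of_not_inArc {η t x : ℝ} (ht : t ∈ Set.Ico (0 : ℝ) (2 * π))
    (hx : x ∈ Set.Ico (0 : ℝ) (2 * π)) (h : ¬ inArc η t x) :
    η ≤ Int.fract ((x - t) / (2 * π)) := by
  have hpi : 0 < 2 * π := by positivity
  by_contra! hlt
  refine h ⟨2 * π * Int.fract ((x - t) / (2 * π)), mul_nonneg hpi.le (Int.fract_nonneg _),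
    mul_lt_mul_of_pos_left hlt hpi, ?_⟩
  rcases fract_div_two_pi ht hx with ⟨-, h⟩ | ⟨-, h⟩ <;> rw [h]
  · left; ring
  · right; ring

/-- If an arc of length `2πη` misses all points, then all points lie within less than `1 - η`
turns counterclockwise of the first point after the arc. -/
theorem exists_forall_fract_lt {ι : Type*} [Finite ι] [Nonempty ι] {η t : ℝ} {θ : ι → ℝ}
    (ht : t ∈ Set.Ico (0 : ℝ) (2 * π)) (hθ : ∀ j, θ j ∈ Set.Ico (0 : ℝ) (2 * π))
    (h : ∀ j, ¬ inArc η t (θ j)) :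
    ∃ j, ∀ k, Int.fract ((θ k - θ j) / (2 * π)) < 1 - η := by
  obtain ⟨j, hj⟩ := Finite.exists_min fun j => Int.fract ((θ j - t) / (2 * π))
  refine ⟨j, fun k => ?_⟩
  have hk1 := Int.fract_lt_one ((θ k - t) / (2 * π))
  have hj0 := Int.fract_nonneg ((θ j - t) / (2 * π))
  have hη := le_fract_of_not_inArc ht (hθ j) (h j)
  have key : Int.fract ((θ k - θ j) / (2 * π)) =
      Int.fract ((θ k - t) / (2 * π)) - Int.fract ((θ j - t) / (2 * π)) := by
    refine Int.fract_eq_iff.2 ⟨sub_nonneg.2 (hj k), by linarith,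
      ⌊(θ k - t) / (2 * π)⌋ - ⌊(θ j - t) / (2 * π)⌋, ?_⟩
    simp only [Int.fract]
    push_cast
    ring
  linarith

theorem uniformCircle_fract_lt_le {η a : ℝ} (hη1 : η ≤ 1)
    (ha : a ∈ Set.Ico (0 : ℝ) (2 * π)) :
    uniformCircle {x | Int.fract ((x - a) / (2 * π)) < 1 - η} ≤ ENNReal.ofReal (1 - η) := by
  have hpi : 0 < 2 * π := by positivity
  have hsub : {x | Int.fract ((x - a) / (2 * π)) < 1 - η} ∩ Set.Ico 0 (2 * π) ⊆
      Set.Ico a (min (2 * π) (a + 2 * π * (1 - η))) ∪ Set.Ico 0 (a - 2 * π * η) := by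
    rintro x ⟨hx, hxI⟩
    have hx' := mul_lt_mul_of_pos_left (show _ < _ from hx) hpi
    rcases fract_div_two_pi ha hxI with ⟨hax, h⟩ | ⟨hax, h⟩ <;> rw [h] at hx'
    · exact Or.inl ⟨hax, lt_min hxI.2 (by linarith)⟩
    · exact Or.inr ⟨hxI.1, by linarith⟩
  have hvol : volume ({x | Int.fract ((x - a) / (2 * π)) < 1 - η} ∩ Set.Ico 0 (2 * π)) ≤
      ENNReal.ofReal (2 * π) * ENNReal.ofReal (1 - η) := by
    refine (measure_mono hsub).trans ((measure_union_le _ _).trans ?_)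
    rw [Real.volume_Ico, Real.volume_Ico, ← ENNReal.ofReal_mul hpi.le]
    have hη : 0 ≤ 2 * π * (1 - η) := mul_nonneg hpi.le (by linarith)
    rcases le_total (a - 2 * π * η) 0 with h | h
    · rw [ENNReal.ofReal_of_nonpos (show a - 2 * π * η - 0 ≤ 0 by linarith), add_zero]
      exact ENNReal.ofReal_le_ofReal (by linarith [min_le_right (2 * π) (a + 2 * π * (1 - η))])
    · rw [min_eq_left (by linarith), ← ENNReal.ofReal_add (by linarith [ha.2]) (by linarith)]
      exact ENNReal.ofReal_le_ofReal (by linarith)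
  rw [uniformCircle, Measure.smul_apply, Measure.restrict_apply' measurableSet_Ico, smul_eq_mul]
  calc _ ≤ (ENNReal.ofReal (2 * π))⁻¹ * (ENNReal.ofReal (2 * π) * ENNReal.ofReal (1 - η)) := by
        gcongr
    _ = _ := by
        rw [← mul_assoc, ENNReal.inv_mul_cancel (ENNReal.ofReal_pos.2 hpi).ne'
          ENNReal.ofReal_ne_top, one_mul]

theorem pi_uniformCircle_forall_fract_lt_le {η : ℝ} (hη1 : η ≤ 1) (n : ℕ)
    (j : Fin (n + 1)) :
    (Measure.pi fun _ : Fin (n + 1) => uniformCircle)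
      {θ | ∀ k, Int.fract ((θ k - θ j) / (2 * π)) < 1 - η} ≤ ENNReal.ofReal (1 - η) ^ n := by
  let B : Set (ℝ × (Fin n → ℝ)) := {p | ∀ k, Int.fract ((p.2 k - p.1) / (2 * π)) < 1 - η}
  have hB : MeasurableSet B := by
    simp only [B, Set.ofPred_forall]
    refine MeasurableSet.iInter fun k => ?_
    exact measurableSet_lt (by fun_prop) measurable_const
  have hmp := measurePreserving_piFinSuccAbove (fun _ : Fin (n + 1) => uniformCircle) j
  calc _ ≤ (Measure.pi fun _ : Fin (n + 1) => uniformCircle)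
          (MeasurableEquiv.piFinSuccAbove (fun _ => ℝ) j ⁻¹' B) :=
        measure_mono fun θ (hθ : ∀ k, _) k => hθ (j.succAbove k)
    _ = ∫⁻ a, (Measure.pi fun _ : Fin n => uniformCircle) (Prod.mk a ⁻¹' B) ∂uniformCircle := by
        rw [hmp.measure_preimage hB.nullMeasurableSet, Measure.prod_apply hB]
    _ ≤ ∫⁻ _, ENNReal.ofReal (1 - η) ^ n ∂uniformCircle := by
        refine lintegral_mono_ae ?_
        filter_upwards [ae_mem_Ico_uniformCircle] with a ha
        have hpre : Prod.mk a ⁻¹' B =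
            Set.univ.pi fun _ => {x | Int.fract ((x - a) / (2 * π)) < 1 - η} := by
          ext; simp [B]
        rw [hpre, Measure.pi_pi, Finset.prod_const, Finset.card_univ, Fintype.card_fin]
        gcongr
        exact uniformCircle_fract_lt_le hη1 ha
    _ = _ := by simp

/-- If `θ₁, …, θᵢ` are i.i.d. uniform on `[0, 2π)` and `0 < η ≤ 1`, the probability that
some arc of angular length `2πη` contains none of them is at most `i(1-η)^(i-1)`. -/
theorem empty_arc_prob_le (i : ℕ) (hi : 1 ≤ i) (η : ℝ) (hη0 : 0 < η) (hη1 : η ≤ 1) :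
    (Measure.pi fun _ : Fin i => uniformCircle)
      {θ : Fin i → ℝ | ∃ t ∈ Set.Ico (0 : ℝ) (2 * π), ∀ j : Fin i, ¬ inArc η t (θ j)}
      ≤ ENNReal.ofReal ((i : ℝ) * (1 - η) ^ (i - 1)) := by
  obtain ⟨n, rfl⟩ : ∃ n, i = n + 1 := ⟨i - 1, by omega⟩
  have hae : ∀ᵐ θ ∂(Measure.pi fun _ : Fin (n + 1) => uniformCircle),
      ∀ j, θ j ∈ Set.Ico (0 : ℝ) (2 * π) :=
    ae_all_iff.2 fun j => (Measure.quasiMeasurePreserving_eval _ j).ae ae_mem_Ico_uniformCircle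
  calc _ ≤ (Measure.pi fun _ : Fin (n + 1) => uniformCircle)
          (⋃ j, {θ | ∀ k, Int.fract ((θ k - θ j) / (2 * π)) < 1 - η}) := by
        refine measure_mono_ae ?_
        filter_upwards [hae] with θ hθ
        rintro ⟨t, ht, h⟩
        exact Set.mem_iUnion.2 (exists_forall_fract_lt ht hθ h)
    _ ≤ ∑ _ : Fin (n + 1), ENNReal.ofReal (1 - η) ^ n :=
        (measure_iUnion_fintype_le _ _).trans
          (Finset.sum_le_sum fun j _ => pi_uniformCircle_forall_fract_lt_le hη1 n j)
    _ = _ := by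
        rw [Finset.sum_const, Finset.card_univ, Fintype.card_fin, nsmul_eq_mul,
          ENNReal.ofReal_mul (by positivity), ENNReal.ofReal_pow (by linarith),
          ENNReal.ofReal_natCast, Nat.add_sub_cancel]
end

section
/- Let 0 < η ≤ 1, 0 < d ≤ 1/2, and N > 0 be real numbers; set a₁ = 4√d(1 − √d) and a₂ = √d(2 − √d), and let (uᵢ)_{i≥0} be a sequence of nonnegative reals with u₀ ≤ 1 and uᵢ ≤ i(1 − η/2)^{i−1} for all i ≥ 1. Then Σ_{l=1}^∞ e^{−a₁N} ((a₁N)^l / l!) · l · (a₂/a₁) · Σ_{i=0}^{l−1} C(l−1, i) (d/(2a₁))^i (1 − d/(2a₁))^{l−1−i} uᵢ ≤ (2 − √d)√d · N e^{−dN/2} + (1 − √d/2) d^{3/2} N² e^{−η dN/4}. -/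
open Real Finset

/-- The mean of `i q ^ (i - 1)` under the binomial weights of `(x + y) ^ n`. -/
theorem sum_choose_mul_deriv (x y q : ℝ) (n : ℕ) :
    ∑ i ∈ range (n + 1), (n.choose i : ℝ) * x ^ i * y ^ (n - i) * ((i : ℝ) * q ^ (i - 1))
      = n * x * (x * q + y) ^ (n - 1) := by
  cases n with
  | zero => simp
  | succ m =>
    rw [sum_range_succ', Nat.add_sub_cancel, add_pow, mul_sum]
    simp only [Nat.cast_zero, zero_mul, mul_zero, add_zero]
    refine sum_congr rfl fun i _ => ?_
    have h : ((m : ℝ) + 1) * m.choose i = (m + 1).choose (i + 1) * ((i : ℝ) + 1) := by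
      exact_mod_cast Nat.add_one_mul_choose_eq m i
    rw [Nat.add_sub_add_right, Nat.add_sub_cancel, mul_pow]
    push_cast
    linear_combination (-(x ^ (i + 1) * y ^ (m - i) * q ^ i)) * h

theorem hasSum_pow_div_factorial (x : ℝ) :
    HasSum (fun n : ℕ => x ^ n / (n.factorial : ℝ)) (exp x) := by
  rw [Real.exp_eq_exp_ℝ]
  exact NormedSpace.expSeries_div_hasSum_exp x

theorem hasSum_mul_pow_div_factorial (x r : ℝ) :
    HasSum (fun n : ℕ => x ^ n / (n.factorial : ℝ) * (n * r ^ (n - 1))) (x * exp (x * r)) := by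
  rw [← hasSum_nat_add_iff' 1]
  simp only [sum_range_one, Nat.cast_zero, zero_mul, mul_zero, sub_zero]
  refine ((hasSum_pow_div_factorial (x * r)).mul_left x).congr_fun fun n => ?_
  rw [Nat.factorial_succ, Nat.add_sub_cancel, mul_pow]
  have := Nat.cast_ne_zero (R := ℝ).mpr n.factorial_ne_zero
  push_cast
  field_simp
  ring

/-- A Poisson mixture of binomial means of a sequence bounded by `i q ^ (i - 1)`. -/
theorem tsum_poisson_binomial_le {x p q : ℝ} (hx : 0 ≤ x) (hp0 : 0 ≤ p) (hp1 : p ≤ 1)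
    {u : ℕ → ℝ} (hu_nonneg : ∀ i, 0 ≤ u i) (hu0 : u 0 ≤ 1)
    (hu : ∀ i : ℕ, 1 ≤ i → u i ≤ (i : ℝ) * q ^ (i - 1)) :
    ∑' l : ℕ, x ^ l / (l.factorial : ℝ) *
        ∑ i ∈ range (l + 1), (l.choose i : ℝ) * p ^ i * (1 - p) ^ (l - i) * u i
      ≤ exp (x * (1 - p)) + p * x * exp (x * (p * q + (1 - p))) := by
  have hp : 0 ≤ 1 - p := sub_nonneg.mpr hp1
  have hmean (l : ℕ) :
      ∑ i ∈ range (l + 1), (l.choose i : ℝ) * p ^ i * (1 - p) ^ (l - i) * u i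
        ≤ (1 - p) ^ l + l * p * (p * q + (1 - p)) ^ (l - 1) := by
    rw [← sum_choose_mul_deriv, sum_range_succ', sum_range_succ' _ l]
    have h : ∑ i ∈ range l, (l.choose (i + 1) : ℝ) * p ^ (i + 1) * (1 - p) ^ (l - (i + 1))
          * u (i + 1)
        ≤ ∑ i ∈ range l, (l.choose (i + 1) : ℝ) * p ^ (i + 1) * (1 - p) ^ (l - (i + 1))
          * (((i + 1 : ℕ) : ℝ) * q ^ (i + 1 - 1)) :=
      sum_le_sum fun i _ => mul_le_mul_of_nonneg_left (hu (i + 1) (by omega)) (by positivity)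
    have h0 := mul_le_mul_of_nonneg_left hu0 (pow_nonneg hp l)
    simp only [Nat.choose_zero_right, Nat.cast_one, pow_zero, one_mul, Nat.sub_zero,
      Nat.cast_zero, zero_mul, mul_zero, add_zero]
    linarith
  have hsum : HasSum (fun l : ℕ => x ^ l / (l.factorial : ℝ) *
      ((1 - p) ^ l + l * p * (p * q + (1 - p)) ^ (l - 1)))
      (exp (x * (1 - p)) + p * x * exp (x * (p * q + (1 - p)))) := by
    rw [mul_assoc p]
    refine ((hasSum_pow_div_factorial (x * (1 - p))).add
      ((hasSum_mul_pow_div_factorial x (p * q + (1 - p))).mul_left p)).congr_fun fun l => ?_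
    rw [mul_pow]
    ring
  have hle (l : ℕ) := mul_le_mul_of_nonneg_left (hmean l)
    (show 0 ≤ x ^ l / (l.factorial : ℝ) by positivity)
  have hnonneg (l : ℕ) : 0 ≤ x ^ l / (l.factorial : ℝ) *
      ∑ i ∈ range (l + 1), (l.choose i : ℝ) * p ^ i * (1 - p) ^ (l - i) * u i :=
    mul_nonneg (by positivity)
      (sum_nonneg fun i _ => mul_nonneg (by positivity) (hu_nonneg i))
  exact hasSum_le hle (Summable.of_nonneg_of_le hnonneg hle hsum.summable).hasSum hsum

/-- The simple bound `(2-√d)√d N e^{-dN/2} + (1-√d/2) d^{3/2} N² e^{-ηdN/4}` on the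
probability that some edge node has an empty `η`disk. -/
theorem edge_empty_disk_bound (η d N : ℝ) (hη0 : 0 < η) (hη1 : η ≤ 1)
    (hd0 : 0 < d) (hd : d ≤ 1 / 2) (hN : 0 < N)
    (u : ℕ → ℝ) (hu_nonneg : ∀ i, 0 ≤ u i) (hu0 : u 0 ≤ 1)
    (hu : ∀ i : ℕ, 1 ≤ i → u i ≤ (i : ℝ) * (1 - η / 2) ^ (i - 1)) :
    (∑' l : ℕ, Real.exp (-(4 * Real.sqrt d * (1 - Real.sqrt d)) * N)
        * (4 * Real.sqrt d * (1 - Real.sqrt d) * N) ^ (l + 1) / (Nat.factorial (l + 1))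
        * (l + 1)
        * (Real.sqrt d * (2 - Real.sqrt d) / (4 * Real.sqrt d * (1 - Real.sqrt d)))
        * ∑ i ∈ Finset.range (l + 1),
            (Nat.choose l i : ℝ) * (d / (2 * (4 * Real.sqrt d * (1 - Real.sqrt d)))) ^ i
              * (1 - d / (2 * (4 * Real.sqrt d * (1 - Real.sqrt d)))) ^ (l - i) * u i)
      ≤ (2 - Real.sqrt d) * Real.sqrt d * N * Real.exp (-d * N / 2)
        + (1 - Real.sqrt d / 2) * d ^ ((3 : ℝ) / 2) * N ^ 2 * Real.exp (-η * d * N / 4) := by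
  have hs0 : 0 < √d := Real.sqrt_pos.mpr hd0
  have hsq : √d * √d = d := Real.mul_self_sqrt hd0.le
  have hs1 : √d ≤ 3 / 4 := by nlinarith
  have hpow : d ^ ((3 : ℝ) / 2) = d * √d := by
    rw [show (3 : ℝ) / 2 = 1 + 1 / 2 by norm_num, Real.rpow_add hd0, Real.rpow_one,
      ← Real.sqrt_eq_rpow]
  rw [hpow]
  have ha : 0 < 4 * √d * (1 - √d) := mul_pos (by linarith) (by linarith)
  have hda : d ≤ 2 * (4 * √d * (1 - √d)) := by nlinarith
  generalize hadef : 4 * √d * (1 - √d) = a at *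
  have hpa : d / (2 * a) * (a * N) = d * N / 2 := by field_simp
  have key := tsum_poisson_binomial_le (x := a * N) (p := d / (2 * a)) (by positivity)
    (by positivity) ((div_le_one (by positivity)).mpr hda) hu_nonneg hu0 hu
  have hc : 0 ≤ rexp (-a * N) * (√d * (2 - √d) * N) :=
    mul_nonneg (exp_pos _).le (mul_nonneg (mul_nonneg hs0.le (by linarith)) hN.le)
  have hkey := mul_le_mul_of_nonneg_left key hc
  rw [← tsum_mul_left] at hkey
  refine (le_of_eq (tsum_congr fun l => ?_)).trans (hkey.trans (le_of_eq ?_))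
  · rw [Nat.factorial_succ]
    have := Nat.cast_ne_zero (R := ℝ).mpr l.factorial_ne_zero
    push_cast
    generalize ∑ i ∈ range (l + 1), (l.choose i : ℝ) * (d / (2 * a)) ^ i
      * (1 - d / (2 * a)) ^ (l - i) * u i = S
    field_simp
    ring
  · have h1 : rexp (-a * N) * rexp (a * N * (1 - d / (2 * a))) = rexp (-d * N / 2) := by
      rw [← Real.exp_add]
      congr 1
      linear_combination -hpa
    have h2 : rexp (-a * N) * rexp (a * N * (d / (2 * a) * (1 - η / 2) + (1 - d / (2 * a))))
        = rexp (-η * d * N / 4) := by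
      rw [← Real.exp_add]
      congr 1
      linear_combination (-η / 2) * hpa
    rw [hpa, ← h1, ← h2]
    ring
end

section
/- Let R > 0 and let μ_R be the uniform probability measure on the half-disk D_R = {(x, y) ∈ ℝ² : x ≥ 0 and x² + y² ≤ R²}. Define g(r, x, y) = √((r − x)² + y²) − r. Then ∫ g(R, x, y) dμ_R(x, y) = R(K − 1), where K = (3·2^{3/2} + 6 ln(1 + √2) + 64 − 5·2^{7/2})/(9π); equivalently, (4/π) ∫₀¹ ∫₀¹ 1_{x² + y² ≤ 1} √((1 − x)² + y²) dx dy = K. -/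
open MeasureTheory Real

/-- The half-disk `D_R = {(x,y) : x ≥ 0, x² + y² ≤ R²}`. -/
def halfDisk (R : ℝ) : Set (ℝ × ℝ) := {p | 0 ≤ p.1 ∧ p.1 ^ 2 + p.2 ^ 2 ≤ R ^ 2}

/-- The uniform probability measure on the half-disk of radius `R`. -/
noncomputable def halfDiskUnif (R : ℝ) : Measure (ℝ × ℝ) :=
  (ENNReal.ofReal (π * R ^ 2 / 2))⁻¹ • volume.restrict (halfDisk R)

/-- `g(r,x,y) = √((r-x)² + y²) - r`, the negative of the one-step progress. -/
noncomputable def gfun (r x y : ℝ) : ℝ := Real.sqrt ((r - x) ^ 2 + y ^ 2) - r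

/-- The constant `K = (3·2^{3/2} + 6 ln(1+√2) + 64 - 5·2^{7/2})/(9π)`. -/
noncomputable def Kconst : ℝ :=
  (3 * (2 : ℝ) ^ ((3 : ℝ) / 2) + 6 * Real.log (1 + Real.sqrt 2) + 64
    - 5 * (2 : ℝ) ^ ((7 : ℝ) / 2)) / (9 * π)

lemma measurableSet_halfDisk (R : ℝ) : MeasurableSet (halfDisk R) := by
  apply IsClosed.measurableSet
  exact (isClosed_le continuous_const continuous_fst).inter
    (isClosed_le (f := fun p : ℝ × ℝ => p.1 ^ 2 + p.2 ^ 2) (by fun_prop) continuous_const)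

lemma halfDisk_subset_box {R : ℝ} (hR : 0 ≤ R) :
    halfDisk R ⊆ Set.Icc 0 R ×ˢ Set.Icc (-R) R := by
  rintro ⟨x, y⟩ ⟨hx, h⟩
  simp only at hx h
  have hx' := abs_le_of_sq_le_sq' (by nlinarith [sq_nonneg y] : x ^ 2 ≤ R ^ 2) hR
  have hy' := abs_le_of_sq_le_sq' (by nlinarith [sq_nonneg x] : y ^ 2 ≤ R ^ 2) hR
  exact ⟨⟨hx, hx'.2⟩, hy'⟩

lemma Continuous.integrableOn_halfDisk {f : ℝ × ℝ → ℝ} (hf : Continuous f) {R : ℝ}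
    (hR : 0 ≤ R) : IntegrableOn f (halfDisk R) :=
  (hf.continuousOn.integrableOn_compact (isCompact_Icc.prod isCompact_Icc)).mono_set
    (halfDisk_subset_box hR)

/-- The half-disk in polar coordinates centred at the origin has area `π R² / 2`. -/
lemma volume_real_halfDisk {R : ℝ} (hR : 0 ≤ R) :
    volume.real (halfDisk R) = π * R ^ 2 / 2 := by
  have hset : polarCoord.target ∩ polarCoord.symm ⁻¹' halfDisk R
      = Set.Ioc 0 R ×ˢ Set.Icc (-(π / 2)) (π / 2) := by
    ext ⟨r, θ⟩
    simp only [polarCoord_target, halfDisk, Set.mem_inter_iff, Set.mem_prod, Set.mem_Ioi,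
      Set.mem_Ioo, Set.mem_preimage, polarCoord_symm_apply, Set.mem_ofPred_eq, Set.mem_Ioc,
      Set.mem_Icc]
    have hsq : (r * cos θ) ^ 2 + (r * sin θ) ^ 2 = r ^ 2 := by
      linear_combination r ^ 2 * sin_sq_add_cos_sq θ
    rw [hsq]
    constructor
    · rintro ⟨⟨hr, h1, h2⟩, h3, h4⟩
      have hc : 0 ≤ cos θ := nonneg_of_mul_nonneg_right h3 hr
      refine ⟨⟨hr, (abs_le_of_sq_le_sq' h4 hR).2⟩, ?_, ?_⟩
      · by_contra! h
        have := cos_neg_of_pi_div_two_lt_of_lt (x := -θ) (by linarith) (by linarith [pi_pos])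
        rw [cos_neg] at this
        linarith
      · by_contra! h
        have := cos_neg_of_pi_div_two_lt_of_lt h (by linarith [pi_pos])
        linarith
    · rintro ⟨⟨hr, hrR⟩, h1, h2⟩
      exact ⟨⟨hr, by linarith [pi_pos], by linarith [pi_pos]⟩,
        mul_nonneg hr.le (cos_nonneg_of_mem_Icc ⟨h1, h2⟩), by gcongr⟩
  have hm : MeasurableSet (polarCoord.symm ⁻¹' halfDisk R) :=
    (measurableSet_halfDisk R).preimage continuous_polarCoord_symm.measurable
  calc volume.real (halfDisk R) = ∫ p, (halfDisk R).indicator (fun _ => (1 : ℝ)) p := by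
        rw [integral_indicator (measurableSet_halfDisk R)]; simp
    _ = ∫ p in polarCoord.target,
          (polarCoord.symm ⁻¹' halfDisk R).indicator (fun p => p.1) p := by
        rw [← integral_comp_polarCoord_symm]
        congr 1 with p
        by_cases h : polarCoord.symm p ∈ halfDisk R
        · rw [Set.indicator_of_mem h, Set.indicator_of_mem (Set.mem_preimage.2 h), smul_eq_mul,
            mul_one]
        · rw [Set.indicator_of_notMem h, Set.indicator_of_notMem (mt Set.mem_preimage.1 h),
            smul_zero]
    _ = ∫ p in Set.Ioc 0 R ×ˢ Set.Icc (-(π / 2)) (π / 2), p.1 * (fun _ => (1 : ℝ)) p.2 := by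
        rw [setIntegral_indicator hm, hset]; simp
    _ = π * R ^ 2 / 2 := by
        rw [Measure.volume_eq_prod, setIntegral_prod_mul (fun r => r) (fun _ => (1 : ℝ)),
          ← intervalIntegral.integral_of_le hR, integral_id]
        simp [pi_pos.le]
        ring

/-- The polar radius, seen from `(1, 0)`, at which the ray of angle `θ` leaves the unit half-disk;
it is nonpositive when the ray does not enter it. -/
noncomputable def chordLength (θ : ℝ) : ℝ := min (2 * cos θ) (cos θ)⁻¹

lemma mem_Ioc_chordLength_iff {R : ℝ} (hR : 0 < R) (r θ : ℝ) :
    r ∈ Set.Ioc 0 (R * chordLength θ) ↔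
      0 < r ∧ 0 ≤ R - r * cos θ ∧ (R - r * cos θ) ^ 2 + (r * sin θ) ^ 2 ≤ R ^ 2 := by
  have hsq : (R - r * cos θ) ^ 2 + (r * sin θ) ^ 2 = R ^ 2 + r * (r - R * (2 * cos θ)) := by
    linear_combination r ^ 2 * sin_sq_add_cos_sq θ
  rw [hsq, Set.mem_Ioc, chordLength, mul_min_of_nonneg _ _ hR.le, le_min_iff]
  refine and_congr_right fun hr => ?_
  have h2 : R ^ 2 + r * (r - R * (2 * cos θ)) ≤ R ^ 2 ↔ r ≤ R * (2 * cos θ) := by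
    rw [add_le_iff_nonpos_right, mul_nonpos_iff_pos_imp_nonpos]
    constructor
    · intro h
      linarith [h.1 hr]
    · intro h
      exact ⟨fun _ => by linarith, fun _ => hr.le⟩
  rw [h2, and_comm]
  refine and_congr_left fun h => ?_
  have hc : 0 < cos θ := by
    by_contra! hc
    nlinarith
  rw [← div_eq_mul_inv, le_div_iff₀ hc, sub_nonneg]

lemma chordLength_le_two (θ : ℝ) : chordLength θ ≤ 2 :=
  (min_le_left _ _).trans (by linarith [cos_le_one θ])

lemma setIntegral_Ioc_sq (m : ℝ) : ∫ r in Set.Ioc 0 m, r ^ 2 = (max m 0) ^ 3 / 3 := by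
  rcases le_total m 0 with h | h
  · simp [h]
  · rw [← intervalIntegral.integral_of_le h, integral_pow, max_eq_left h]
    norm_num

/-- Polar coordinates around `(R, 0)` reduce the integral of the distance to that point over
the half-disk to an integral over the angle. -/
lemma setIntegral_halfDisk_dist {R : ℝ} (hR : 0 < R) :
    ∫ p in halfDisk R, √((R - p.1) ^ 2 + p.2 ^ 2) =
      R ^ 3 * ∫ θ in Set.Ioo (-π) π, (max (chordLength θ) 0) ^ 3 / 3 := by
  set T : Set (ℝ × ℝ) := (fun p => ((R, 0) : ℝ × ℝ) - polarCoord.symm p) ⁻¹' halfDisk R with hT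
  have hTm : MeasurableSet T := (measurableSet_halfDisk R).preimage
    (continuous_const.sub continuous_polarCoord_symm).measurable
  have hmem : ∀ p : ℝ × ℝ, p ∈ polarCoord.target ∩ T ↔
      p.2 ∈ Set.Ioo (-π) π ∧ p.1 ∈ Set.Ioc 0 (R * chordLength p.2) := by
    rintro ⟨r, θ⟩
    rw [mem_Ioc_chordLength_iff hR]
    simp [polarCoord_target, hT, halfDisk, polarCoord_symm_apply]
    tauto
  have hint : IntegrableOn (fun p : ℝ × ℝ => p.1 ^ 2) (polarCoord.target ∩ T) := by
    refine ((by fun_prop : Continuous fun p : ℝ × ℝ => p.1 ^ 2).continuousOn.integrableOn_compact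
      (isCompact_Icc.prod isCompact_Icc)).mono_set
      (t := Set.Icc 0 (R * 2) ×ˢ Set.Icc (-π) π) ?_
    intro p hp
    obtain ⟨h1, h2⟩ := (hmem p).1 hp
    exact ⟨⟨h2.1.le, h2.2.trans (by gcongr; exact chordLength_le_two _)⟩, h1.1.le, h1.2.le⟩
  have htm : MeasurableSet (polarCoord.target ∩ T) :=
    polarCoord.open_target.measurableSet.inter hTm
  calc ∫ p in halfDisk R, √((R - p.1) ^ 2 + p.2 ^ 2)
      = ∫ p, (halfDisk R).indicator (fun p => √((R - p.1) ^ 2 + p.2 ^ 2)) p :=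
        (integral_indicator (measurableSet_halfDisk R)).symm
    _ = ∫ p in polarCoord.target, T.indicator (fun p => p.1 ^ 2) p := by
        rw [← integral_sub_left_eq_self _ _ ((R, 0) : ℝ × ℝ), ← integral_comp_polarCoord_symm]
        refine setIntegral_congr_fun polarCoord.open_target.measurableSet fun p hp => ?_
        have hp0 : 0 < p.1 := by
          rw [polarCoord_target] at hp
          exact hp.1
        by_cases h : p ∈ T
        · have h' : ((R, 0) : ℝ × ℝ) - polarCoord.symm p ∈ halfDisk R := h
          have hsq : (p.1 * cos p.2) ^ 2 + (p.1 * sin p.2) ^ 2 = p.1 ^ 2 := by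
            linear_combination p.1 ^ 2 * sin_sq_add_cos_sq p.2
          simp only [Set.indicator_of_mem h, Set.indicator_of_mem h']
          simp only [polarCoord_symm_apply, Prod.fst_sub, Prod.snd_sub, sub_sub_cancel, zero_sub,
            neg_sq, hsq, sqrt_sq hp0.le, smul_eq_mul]
          ring
        · have h' : ((R, 0) : ℝ × ℝ) - polarCoord.symm p ∉ halfDisk R := h
          simp only [Set.indicator_of_notMem h, Set.indicator_of_notMem h', smul_zero]
    _ = ∫ p, (polarCoord.target ∩ T).indicator (fun p => p.1 ^ 2) p := by
        rw [setIntegral_indicator hTm, integral_indicator htm]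
    _ = ∫ θ, ∫ r, (polarCoord.target ∩ T).indicator (fun p => p.1 ^ 2) (r, θ) :=
        integral_prod_symm _ ((integrable_indicator_iff htm).2 hint)
    _ = ∫ θ, (Set.Ioo (-π) π).indicator
          (fun θ => R ^ 3 * ((max (chordLength θ) 0) ^ 3 / 3)) θ := by
        congr 1 with θ
        by_cases h : θ ∈ Set.Ioo (-π) π
        · have hfun : (fun r => (polarCoord.target ∩ T).indicator (fun p => p.1 ^ 2) (r, θ))
              = (Set.Ioc 0 (R * chordLength θ)).indicator fun r => r ^ 2 := by
            ext r
            have := hmem (r, θ)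
            by_cases h3 : r ∈ Set.Ioc 0 (R * chordLength θ)
            · rw [Set.indicator_of_mem h3, Set.indicator_of_mem (this.2 ⟨h, h3⟩)]
            · rw [Set.indicator_of_notMem h3, Set.indicator_of_notMem fun h4 => h3 (this.1 h4).2]
          rw [hfun, integral_indicator measurableSet_Ioc, setIntegral_Ioc_sq,
            Set.indicator_of_mem h, ← mul_zero R, ← mul_max_of_nonneg _ _ hR.le, mul_zero]
          ring
        · rw [Set.indicator_of_notMem h]
          refine integral_eq_zero_of_ae (Filter.Eventually.of_forall fun r => ?_)
          exact Set.indicator_of_notMem (fun h4 => h ((hmem (r, θ)).1 h4).1) _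
    _ = _ := by rw [integral_indicator measurableSet_Ioo, integral_const_mul]

lemma integral_inv_cos_pow_three :
    ∫ θ in (0 : ℝ)..(π / 4), (cos θ)⁻¹ ^ 3 = (√2 + log (1 + √2)) / 2 := by
  have hcos : ∀ θ ∈ Set.uIcc 0 (π / 4), 0 < cos θ := by
    intro θ hθ
    rw [Set.uIcc_of_le (by positivity)] at hθ
    exact cos_pos_of_mem_Ioo ⟨by linarith [hθ.1, pi_pos], by linarith [hθ.2, pi_pos]⟩
  have hderiv : ∀ θ ∈ Set.uIcc 0 (π / 4), HasDerivAt
      (fun θ => (sin θ / cos θ ^ 2 + (log (1 + sin θ) - log (cos θ))) / 2)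
      ((cos θ)⁻¹ ^ 3) θ := by
    intro θ hθ
    have hc := hcos θ hθ
    have hs : 0 < 1 + sin θ := by nlinarith [sin_sq_add_cos_sq θ, neg_one_le_sin θ]
    have h := ((((hasDerivAt_sin θ).div ((hasDerivAt_cos θ).pow 2) (pow_ne_zero 2 hc.ne')).add
      ((((hasDerivAt_sin θ).const_add 1).log hs.ne').sub
        ((hasDerivAt_cos θ).log hc.ne'))).div_const 2)
    refine HasDerivAt.congr_deriv h ?_
    have hsc : cos θ ^ 2 = 1 - sin θ ^ 2 := by linarith [sin_sq_add_cos_sq θ]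
    simp only [Pi.pow_apply, Nat.cast_ofNat, Nat.add_one_sub_one, pow_one]
    field_simp
    linear_combination ((1 + sin θ) + (cos θ ^ 2 + 1 - sin θ ^ 2) + sin θ * (1 + sin θ)) * hsc
  rw [intervalIntegral.integral_eq_sub_of_hasDerivAt hderiv]
  · have h2 : (√2 : ℝ) ^ 2 = 2 := by norm_num
    have hlog : log (1 + √2 / 2) - log (√2 / 2) = log (1 + √2) := by
      rw [← log_div (by positivity) (by positivity)]
      congr 1
      field_simp
      linarith
    simp only [sin_pi_div_four, cos_pi_div_four, hlog, sin_zero, cos_zero]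
    simp
    field_simp
    linarith
  · refine ContinuousOn.intervalIntegrable ?_
    exact (continuous_cos.continuousOn.inv₀ fun θ hθ => (hcos θ hθ).ne').pow 3

lemma integral_cos_pow_three_quarter :
    ∫ θ in (π / 4)..(π / 2), cos θ ^ 3 = 2 / 3 - 5 * √2 / 12 := by
  rw [integral_cos_pow_three]
  have h2 : (√2 : ℝ) ^ 3 = 2 * √2 := by
    rw [pow_succ]; norm_num
  simp only [sin_pi_div_two, sin_pi_div_four, div_pow, h2]
  ring

lemma measurable_chordLength : Measurable chordLength := by
  unfold chordLength
  fun_prop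

lemma integral_chordLength_pow_three :
    ∫ θ in Set.Ioo (-π) π, (max (chordLength θ) 0) ^ 3 / 3 = π / 2 * Kconst := by
  set h : ℝ → ℝ := fun θ => (max (chordLength θ) 0) ^ 3 / 3 with hh
  have hii : ∀ a b, IntervalIntegrable h volume a b := by
    intro a b
    rw [intervalIntegrable_iff]
    refine Measure.integrableOn_of_bounded (M := 8 / 3) (by simp) ?_ ?_
    · have := measurable_chordLength
      exact (by fun_prop : Measurable h).aestronglyMeasurable
    · refine Filter.Eventually.of_forall fun θ => ?_
      have h0 : 0 ≤ max (chordLength θ) 0 := le_max_right _ _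
      have h2 : max (chordLength θ) 0 ≤ 2 := max_le (chordLength_le_two θ) (by norm_num)
      have h3 : (max (chordLength θ) 0) ^ 3 ≤ 2 ^ 3 := by gcongr
      rw [norm_of_nonneg (by positivity)]
      simp only [hh]
      linarith
  have heven : ∫ θ in (-π)..0, h θ = ∫ θ in (0 : ℝ)..π, h θ := by
    have := intervalIntegral.integral_comp_neg (a := 0) (b := π) h
    rw [neg_zero] at this
    rw [← this]
    simp [hh, chordLength]
  have hlow : ∫ θ in (0 : ℝ)..(π / 4), h θ = ∫ θ in (0 : ℝ)..(π / 4), (cos θ)⁻¹ ^ 3 / 3 := by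
    refine intervalIntegral.integral_congr fun θ hθ => ?_
    rw [Set.uIcc_of_le (by positivity)] at hθ
    have hc : √2 / 2 ≤ cos θ := by
      rw [← cos_pi_div_four]
      exact cos_le_cos_of_nonneg_of_le_pi hθ.1 (by linarith [pi_pos]) hθ.2
    have hc0 : 0 < cos θ := lt_of_lt_of_le (by positivity) hc
    have hsq : (√2 / 2) ^ 2 ≤ cos θ ^ 2 := by gcongr
    rw [div_pow, sq_sqrt (by norm_num)] at hsq
    have hle : (cos θ)⁻¹ ≤ 2 * cos θ := by
      rw [inv_le_iff_one_le_mul₀ hc0]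
      nlinarith
    simp only [hh, chordLength]
    rw [min_eq_right hle, max_eq_left (by positivity)]
  have hmid : ∫ θ in (π / 4)..(π / 2), h θ = ∫ θ in (π / 4)..(π / 2), 8 / 3 * cos θ ^ 3 := by
    refine intervalIntegral.integral_congr fun θ hθ => ?_
    rw [Set.uIcc_of_le (by linarith [pi_pos])] at hθ
    have hc : cos θ ≤ √2 / 2 := by
      rw [← cos_pi_div_four]
      exact cos_le_cos_of_nonneg_of_le_pi (by positivity) (by linarith [pi_pos, hθ.2]) hθ.1
    have hc0 : 0 ≤ cos θ := cos_nonneg_of_mem_Icc ⟨by linarith [pi_pos, hθ.1], hθ.2⟩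
    have hsq : cos θ ^ 2 ≤ (√2 / 2) ^ 2 := by gcongr
    rw [div_pow, sq_sqrt (by norm_num)] at hsq
    simp only [hh, chordLength]
    rcases hc0.eq_or_lt with h0 | h0
    · simp [← h0]
    · have hle : 2 * cos θ ≤ (cos θ)⁻¹ := by
        rw [le_inv_comm₀ (by positivity) h0, ← one_div, le_div_iff₀ (by positivity)]
        nlinarith
      rw [min_eq_left hle, max_eq_left (by positivity)]
      ring
  have hhigh : ∫ θ in (π / 2)..π, h θ = 0 := by
    refine (intervalIntegral.integral_congr (g := fun _ => (0 : ℝ)) fun θ hθ => ?_).trans (by simp)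
    rw [Set.uIcc_of_le (by linarith [pi_pos])] at hθ
    have hc : cos θ ≤ 0 := cos_nonpos_of_pi_div_two_le_of_le hθ.1 (by linarith [hθ.2, pi_pos])
    simp only [hh, chordLength]
    rw [max_eq_right ((min_le_left _ _).trans (by linarith))]
    norm_num
  have h32 : (2 : ℝ) ^ ((3 : ℝ) / 2) = 2 * √2 := by
    rw [show (3 : ℝ) / 2 = 1 + 1 / 2 by norm_num, rpow_add (by norm_num), rpow_one, sqrt_eq_rpow]
  have h72 : (2 : ℝ) ^ ((7 : ℝ) / 2) = 8 * √2 := by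
    rw [show (7 : ℝ) / 2 = (3 : ℕ) + 1 / 2 by norm_num, rpow_add (by norm_num), rpow_natCast,
      sqrt_eq_rpow]
    norm_num
  rw [← integral_Ioc_eq_integral_Ioo, ← intervalIntegral.integral_of_le (by linarith [pi_pos]),
    ← intervalIntegral.integral_add_adjacent_intervals (hii _ 0) (hii _ _), heven,
    ← intervalIntegral.integral_add_adjacent_intervals (hii 0 (π / 2)) (hii _ _),
    ← intervalIntegral.integral_add_adjacent_intervals (hii 0 (π / 4)) (hii _ _),
    hlow, hmid, hhigh, intervalIntegral.integral_div, intervalIntegral.integral_const_mul,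
    integral_inv_cos_pow_three, integral_cos_pow_three_quarter, Kconst, h32, h72]
  field_simp
  ring

lemma setIntegral_halfDisk_dist_eq {R : ℝ} (hR : 0 < R) :
    ∫ p in halfDisk R, √((R - p.1) ^ 2 + p.2 ^ 2) = R ^ 3 * (π / 2 * Kconst) := by
  rw [setIntegral_halfDisk_dist hR, integral_chordLength_pow_three]

lemma integral_gfun_halfDiskUnif {R : ℝ} (hR : 0 < R) :
    ∫ p : ℝ × ℝ, gfun R p.1 p.2 ∂(halfDiskUnif R) = R * (Kconst - 1) := by
  have hpi := pi_pos
  have hdist : Continuous fun p : ℝ × ℝ => √((R - p.1) ^ 2 + p.2 ^ 2) := by fun_prop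
  simp only [gfun, halfDiskUnif]
  rw [integral_smul_measure, integral_sub (hdist.integrableOn_halfDisk hR.le)
    (continuous_const.integrableOn_halfDisk hR.le), setIntegral_halfDisk_dist_eq hR,
    setIntegral_const, volume_real_halfDisk hR.le, ENNReal.toReal_inv,
    ENNReal.toReal_ofReal (by positivity), smul_eq_mul, smul_eq_mul]
  field_simp

/-- The unit half-disk integral of the distance to `(1, 0)` is twice the quarter-disk one,
written as an iterated integral over the unit square. -/
lemma setIntegral_halfDisk_one_eq_two_mul :
    ∫ p in halfDisk 1, √((1 - p.1) ^ 2 + p.2 ^ 2) =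
      2 * ∫ x in (0 : ℝ)..1, ∫ y in (0 : ℝ)..1,
        (if x ^ 2 + y ^ 2 ≤ 1 then √((1 - x) ^ 2 + y ^ 2) else 0) := by
  set F : ℝ × ℝ → ℝ :=
    fun p => if p.1 ^ 2 + p.2 ^ 2 ≤ 1 then √((1 - p.1) ^ 2 + p.2 ^ 2) else 0 with hF
  set B : Set (ℝ × ℝ) := Set.Icc 0 1 ×ˢ Set.Icc (-1) 1 with hB
  set C : Set (ℝ × ℝ) := {p | p.1 ^ 2 + p.2 ^ 2 ≤ 1} with hC
  have hCm : MeasurableSet C :=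
    (isClosed_le (by fun_prop) continuous_const : IsClosed C).measurableSet
  have hFC : F = C.indicator fun p => √((1 - p.1) ^ 2 + p.2 ^ 2) := by
    ext p
    simp [hF, hC, Set.indicator_apply]
  have hBC : B ∩ C = halfDisk 1 := by
    ext p
    constructor
    · rintro ⟨h1, h2⟩
      exact ⟨h1.1.1, by simpa [hC] using h2⟩
    · intro h
      exact ⟨halfDisk_subset_box zero_le_one h, by simpa [hC] using h.2⟩
  have hdist : Continuous fun p : ℝ × ℝ => √((1 - p.1) ^ 2 + p.2 ^ 2) := by fun_prop
  have hFi : IntegrableOn F B := by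
    rw [hFC, IntegrableOn, integrable_indicator_iff hCm, IntegrableOn,
      Measure.restrict_restrict hCm, Set.inter_comm, hBC]
    exact hdist.integrableOn_halfDisk zero_le_one
  have hslice : ∀ x a b, IntervalIntegrable (fun y => F (x, y)) volume a b := by
    intro x a b
    have hcont : Continuous fun y : ℝ => √((1 - x) ^ 2 + y ^ 2) := by fun_prop
    have hm : MeasurableSet {y : ℝ | x ^ 2 + y ^ 2 ≤ 1} :=
      (isClosed_le (by fun_prop) continuous_const).measurableSet
    have : (fun y => F (x, y)) =
        {y : ℝ | x ^ 2 + y ^ 2 ≤ 1}.indicator fun y => √((1 - x) ^ 2 + y ^ 2) := by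
      ext y
      simp [hF, Set.indicator_apply]
    rw [this, intervalIntegrable_iff]
    exact (intervalIntegrable_iff.1 (hcont.intervalIntegrable a b)).indicator hm
  have hsymm : ∀ x, ∫ y in Set.Icc (-1 : ℝ) 1, F (x, y) = 2 * ∫ y in (0 : ℝ)..1, F (x, y) := by
    intro x
    have hneg := intervalIntegral.integral_comp_neg (a := 0) (b := 1) fun y => F (x, y)
    rw [neg_zero] at hneg
    rw [integral_Icc_eq_integral_Ioc, ← intervalIntegral.integral_of_le (by norm_num),
      ← intervalIntegral.integral_add_adjacent_intervals (hslice x (-1) 0) (hslice x 0 1), ← hneg]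
    simp only [hF, neg_sq]
    ring
  calc ∫ p in halfDisk 1, √((1 - p.1) ^ 2 + p.2 ^ 2) = ∫ p in B, F p := by
        rw [hFC, setIntegral_indicator hCm, hBC]
    _ = ∫ x in Set.Icc (0 : ℝ) 1, ∫ y in Set.Icc (-1 : ℝ) 1, F (x, y) := setIntegral_prod F hFi
    _ = _ := by
        simp_rw [hsymm]
        rw [integral_const_mul, integral_Icc_eq_integral_Ioc,
          ← intervalIntegral.integral_of_le zero_le_one]

/-- `∫ g(R,x,y) dμ_R = R(K-1)`, and equivalently the normalized double integral over the
unit square of `1_{x²+y²≤1} √((1-x)²+y²)` equals `K`. -/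
theorem halfDisk_g_integral (R : ℝ) (hR : 0 < R) :
    (∫ p : ℝ × ℝ, gfun R p.1 p.2 ∂(halfDiskUnif R)) = R * (Kconst - 1) ∧
    (4 / π) * (∫ x in (0 : ℝ)..1, ∫ y in (0 : ℝ)..1,
        (if x ^ 2 + y ^ 2 ≤ 1 then Real.sqrt ((1 - x) ^ 2 + y ^ 2) else 0)) = Kconst := by
  refine ⟨integral_gfun_halfDiskUnif hR, ?_⟩
  have h := setIntegral_halfDisk_one_eq_two_mul.symm.trans
    (setIntegral_halfDisk_dist_eq zero_lt_one)
  have hpi := pi_pos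
  field_simp
  linarith
end

section
/- Let p, q, s > 0 be real numbers, and let E(p, q, s) = Σ_{n=0}^∞ Σ_{m=1}^∞ (n/(n + m)) · (q^m / m!) e^{−q} · ((p + s) e^{−(p+s)} / (1 − e^{−(p+s)})) · (p^n / n!) · ∫₀¹ y^n e^{s y} dy. Then E(p, q, s) < (p/(p + q)) · (1 − ((p + s)/s) · ((1 − e^{−s})/(1 − e^{−(p+s)})) · e^{−(p+q)}). In particular E(p, q, s) < p/(p + q). -/
open Real

/-- The conditional expectation `E[φ'(C∩D)/φ'(C); φ'(C)>0 | φ(D)>0]` arising from a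
Poisson point process with one uniformly chosen point of `D` removed, where
`p = λ|C∩D|`, `q = λ|C∩Dᶜ|`, `s = λ|Cᶜ∩D|`. -/
noncomputable def markovExp (p q s : ℝ) : ℝ :=
  ∑' n : ℕ, ∑' m : ℕ,
    ((n : ℝ) / (n + (m + 1))) * (q ^ (m + 1) / Nat.factorial (m + 1)) * Real.exp (-q)
      * ((p + s) * Real.exp (-(p + s)) / (1 - Real.exp (-(p + s))))
      * (p ^ n / Nat.factorial n)
      * ∫ y in (0 : ℝ)..1, y ^ n * Real.exp (s * y)

open Finset in
/-- Two-variable exponential series weighted by the fraction `n / (n + m)`. -/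
theorem hasSum_fraction_mul_pow_div_factorial {x q : ℝ} (hx : 0 ≤ x) (hq : 0 < q) :
    HasSum (fun i : ℕ × ℕ => (i.1 : ℝ) / (i.1 + i.2) *
        (x ^ i.1 / Nat.factorial i.1 * (q ^ i.2 / Nat.factorial i.2)))
      (x / (x + q) * (exp (x + q) - 1)) := by
  have hxq : x + q ≠ 0 := by positivity
  have hsummable : Summable (fun i : ℕ × ℕ => (i.1 : ℝ) / (i.1 + i.2) *
      (x ^ i.1 / Nat.factorial i.1 * (q ^ i.2 / Nat.factorial i.2))) := by
    refine Summable.of_nonneg_of_le (fun i => by positivity) (fun i => ?_)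
      ((Real.summable_pow_div_factorial x).mul_of_nonneg (Real.summable_pow_div_factorial q)
        (fun n => by positivity) (fun n => by positivity))
    exact mul_le_of_le_one_left (by positivity)
      (div_le_one_of_le₀ (by simp) (by positivity))
  have hanti (k : ℕ) : ∑ i ∈ antidiagonal k, (i.1 : ℝ) / (i.1 + i.2) *
      (x ^ i.1 / Nat.factorial i.1 * (q ^ i.2 / Nat.factorial i.2)) =
      x / (x + q) * ((x + q) ^ k / Nat.factorial k - if k = 0 then 1 else 0) := by
    cases k with
    | zero => simp
    | succ k =>
      rw [Nat.sum_antidiagonal_succ]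
      have hpow : (x + q) ^ k = ∑ i ∈ antidiagonal k, (Nat.factorial k : ℝ) *
          (x ^ i.1 / Nat.factorial i.1 * (q ^ i.2 / Nat.factorial i.2)) := by
        rw [(Commute.all x q).add_pow']
        refine sum_congr rfl fun i hi => ?_
        obtain rfl := mem_antidiagonal.1 hi
        rw [nsmul_eq_mul, Nat.cast_add_choose]
        field_simp
      rw [pow_succ (x + q), hpow, sum_mul, sum_div]
      simp only [Nat.cast_zero, zero_div, zero_mul, zero_add, Nat.add_eq_zero_iff, one_ne_zero,
        and_false, if_false, sub_zero]
      rw [mul_sum]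
      refine sum_congr rfl fun i hi => ?_
      have hk : (i.1 : ℝ) + i.2 = k := by exact_mod_cast mem_antidiagonal.1 hi
      have hk' : ((i.1 + 1 : ℕ) : ℝ) + i.2 = k + 1 := by push_cast; linarith
      rw [hk', Nat.factorial_succ, Nat.factorial_succ]
      push_cast
      field_simp
      ring
  have hexp : HasSum (fun k : ℕ => x / (x + q) *
      ((x + q) ^ k / Nat.factorial k - if k = 0 then 1 else 0))
      (x / (x + q) * (exp (x + q) - 1)) := by
    refine HasSum.mul_left _ (HasSum.sub ?_ (hasSum_ite_eq 0 1))
    rw [Real.exp_eq_exp_ℝ]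
    exact NormedSpace.expSeries_div_hasSum_exp (x + q)
  have hsigma := (HasAntidiagonal.sigmaAntidiagonalEquivProd.summable_iff.2 hsummable).hasSum
  have hsum := hsigma.sigma fun k => hasSum_fintype _
  have hcongr := hexp.congr_fun fun k => (Eq.trans
    (sum_coe_sort (antidiagonal k) fun i : ℕ × ℕ => (i.1 : ℝ) / (i.1 + i.2) *
      (x ^ i.1 / Nat.factorial i.1 * (q ^ i.2 / Nat.factorial i.2))) (hanti k))
  rw [← hsum.unique hcongr]
  exact HasAntidiagonal.sigmaAntidiagonalEquivProd.hasSum_iff.1 hsigma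

/-- Termwise integration of the weighted exponential series. -/
theorem hasSum_fraction_mul_integral {p q s : ℝ} (hp : 0 < p) (hq : 0 < q) (hs : 0 < s) :
    HasSum (fun i : ℕ × ℕ => (i.1 : ℝ) / (i.1 + i.2) *
        (p ^ i.1 / Nat.factorial i.1 * (q ^ i.2 / Nat.factorial i.2)) *
        ∫ y in (0 : ℝ)..1, y ^ i.1 * exp (s * y))
      (∫ y in (0 : ℝ)..1, p * y / (p * y + q) * (exp (p * y + q) - 1) * exp (s * y)) := by
  have hdom := intervalIntegral.hasSum_integral_of_dominated_convergence
    (μ := MeasureTheory.volume) (a := 0) (b := 1)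
    (F := fun (i : ℕ × ℕ) (y : ℝ) => (i.1 : ℝ) / (i.1 + i.2) *
        (p ^ i.1 / Nat.factorial i.1 * (q ^ i.2 / Nat.factorial i.2)) *
        (y ^ i.1 * exp (s * y)))
    (f := fun y => p * y / (p * y + q) * (exp (p * y + q) - 1) * exp (s * y))
    (fun i _ => p ^ i.1 / Nat.factorial i.1 * (q ^ i.2 / Nat.factorial i.2) * exp s)
    (fun i => by
      refine Continuous.aestronglyMeasurable ?_
      fun_prop)
    (fun i => Filter.Eventually.of_forall fun y hy => ?_)
    (Filter.Eventually.of_forall fun y _ => ?_) (by simp)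
    (Filter.Eventually.of_forall fun y hy => ?_)
  · simpa only [intervalIntegral.integral_const_mul] using hdom
  · rw [Set.uIoc_of_le zero_le_one] at hy
    have hy0 := hy.1
    rw [Real.norm_of_nonneg (by positivity)]
    have hfrac : (i.1 : ℝ) / (i.1 + i.2) ≤ 1 := div_le_one_of_le₀ (by simp) (by positivity)
    have hpow : y ^ i.1 ≤ 1 := pow_le_one₀ hy0.le hy.2
    have hexp : exp (s * y) ≤ exp s := exp_le_exp.2 (by nlinarith [hy.2])
    have hprod : y ^ i.1 * exp (s * y) ≤ exp s :=
      (mul_le_of_le_one_left (by positivity) hpow).trans hexp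
    exact mul_le_mul (mul_le_of_le_one_left (by positivity) hfrac) hprod (by positivity)
      (by positivity)
  · exact ((Real.summable_pow_div_factorial p).mul_of_nonneg (Real.summable_pow_div_factorial q)
        (fun n => by positivity) (fun n => by positivity)).mul_right _
  · rw [Set.uIoc_of_le zero_le_one] at hy
    have hy0 := hy.1
    refine ((hasSum_fraction_mul_pow_div_factorial (mul_nonneg hp.le hy0.le) hq).mul_right
      (exp (s * y))).congr_fun fun i => ?_
    rw [mul_pow]
    ring

theorem integral_fraction_mul_exp_lt {p q s : ℝ} (hp : 0 < p) (hq : 0 < q) (hs : 0 < s) :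
    ∫ y in (0 : ℝ)..1, p * y / (p * y + q) * (exp (p * y + q) - 1) * exp (s * y) <
      p / (p + q) * (exp q * ((exp (p + s) - 1) / (p + s)) - (exp s - 1) / s) := by
  have hint {c : ℝ} (hc : 0 < c) : ∫ y in (0 : ℝ)..1, exp (c * y) = (exp c - 1) / c := by
    rw [intervalIntegral.integral_comp_mul_left _ hc.ne', integral_exp]
    simp [div_eq_inv_mul]
  have heval : ∫ y in (0 : ℝ)..1, p / (p + q) * (exp (p * y + q) - 1) * exp (s * y) =
      p / (p + q) * (exp q * ((exp (p + s) - 1) / (p + s)) - (exp s - 1) / s) := by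
    rw [← hint (add_pos hp hs), ← hint hs, ← intervalIntegral.integral_const_mul,
      ← intervalIntegral.integral_sub
        (Continuous.intervalIntegrable (by fun_prop) _ _)
        (Continuous.intervalIntegrable (by fun_prop) _ _),
      ← intervalIntegral.integral_const_mul]
    congr 1 with y
    rw [show (p + s) * y = p * y + s * y by ring, exp_add, exp_add]
    ring
  rw [← heval]
  have hle {y : ℝ} (hy0 : 0 ≤ y) : 0 < exp (p * y + q) - 1 :=
    sub_pos.2 (one_lt_exp_iff.2 (by positivity))
  refine intervalIntegral.integral_lt_integral_of_continuousOn_of_le_of_exists_lt zero_lt_one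
    ?_ (by fun_prop) (fun y hy => ?_) ⟨0, by simp, ?_⟩
  · have hne : ∀ y ∈ Set.Icc (0 : ℝ) 1, p * y + q ≠ 0 := fun y hy => by
      have := mul_nonneg hp.le hy.1
      positivity
    fun_prop (disch := assumption)
  · have hy0 := hy.1
    have hpos := (hle hy0.le).le
    have hfrac : p * y / (p * y + q) ≤ p / (p + q) := by
      rw [div_le_div_iff₀ (by positivity) (by positivity)]
      nlinarith [mul_nonneg (mul_pos hp hq).le (sub_nonneg.2 hy.2)]
    gcongr
  · have hpos := hle le_rfl
    have : 0 < p / (p + q) * (exp (p * 0 + q) - 1) * exp (s * 0) := by positivity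
    simpa using this

theorem markovExp_le_mul_integral {p q s : ℝ} (hp : 0 < p) (hq : 0 < q) (hs : 0 < s) :
    markovExp p q s ≤ exp (-q) * ((p + s) * exp (-(p + s)) / (1 - exp (-(p + s)))) *
      ∫ y in (0 : ℝ)..1, p * y / (p * y + q) * (exp (p * y + q) - 1) * exp (s * y) := by
  have hK : 0 < 1 - exp (-(p + s)) := sub_pos.2 (exp_lt_one_iff.2 (by linarith))
  have hsum := hasSum_fraction_mul_integral hp hq hs
  have hinj : Function.Injective (Prod.map id Nat.succ : ℕ × ℕ → ℕ × ℕ) :=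
    Function.injective_id.prodMap Nat.succ_injective
  have hnonneg (i : ℕ × ℕ) : 0 ≤ (i.1 : ℝ) / (i.1 + i.2) *
        (p ^ i.1 / Nat.factorial i.1 * (q ^ i.2 / Nat.factorial i.2)) *
        ∫ y in (0 : ℝ)..1, y ^ i.1 * exp (s * y) := by
    refine mul_nonneg (by positivity)
      (intervalIntegral.integral_nonneg zero_le_one fun y hy => ?_)
    have := hy.1
    positivity
  have hle := tsum_comp_le_tsum_of_inj hsum.summable hnonneg hinj
  rw [hsum.tsum_eq, (hsum.summable.comp_injective hinj).tsum_prod] at hle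
  refine le_of_eq_of_le ?_ (mul_le_mul_of_nonneg_left hle (by positivity))
  rw [markovExp, ← tsum_mul_left]
  refine tsum_congr fun n => ?_
  rw [← tsum_mul_left]
  refine tsum_congr fun m => ?_
  simp only [Function.comp_apply, Prod.map, id, Nat.succ_eq_add_one]
  push_cast
  ring

/-- Upper bound: `E(p,q,s) < (p/(p+q))·(1 - ((p+s)/s)·((1-e^{-s})/(1-e^{-(p+s)}))·e^{-(p+q)})`,
and in particular `E(p,q,s) < p/(p+q)`. -/
theorem markovExp_upper_bound (p q s : ℝ) (hp : 0 < p) (hq : 0 < q) (hs : 0 < s) :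
    markovExp p q s
      < (p / (p + q)) * (1 - ((p + s) / s) * ((1 - Real.exp (-s))
          / (1 - Real.exp (-(p + s)))) * Real.exp (-(p + q))) ∧
    markovExp p q s < p / (p + q) := by
  have hKs : 0 < 1 - exp (-(p + s)) := sub_pos.2 (exp_lt_one_iff.2 (by linarith))
  have hS : 0 < 1 - exp (-s) := sub_pos.2 (exp_lt_one_iff.2 (by linarith))
  have hmain : markovExp p q s
      < (p / (p + q)) * (1 - ((p + s) / s) * ((1 - Real.exp (-s))
          / (1 - Real.exp (-(p + s)))) * Real.exp (-(p + q))) := by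
    refine (markovExp_le_mul_integral hp hq hs).trans_lt
      ((mul_lt_mul_of_pos_left (integral_fraction_mul_exp_lt hp hq hs)
        (by positivity)).trans_eq ?_)
    have hne : exp p * exp s - 1 ≠ 0 := by
      rw [← exp_add]
      exact (sub_pos.2 (one_lt_exp_iff.2 (by positivity))).ne'
    simp only [exp_neg, exp_add, mul_inv] at hKs ⊢
    have hden : 1 - (exp p)⁻¹ * (exp s)⁻¹ = (exp p * exp s - 1) / (exp p * exp s) := by
      field_simp
    rw [hden]
    field_simp
  refine ⟨hmain, hmain.trans ?_⟩
  refine mul_lt_of_lt_one_right (by positivity) (sub_lt_self _ (by positivity))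
end
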